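/- Let k ≥ 2 and let f be a polymatroid on 2^{[k]} that is strictly submodular (f(S) + f(T) > f(S ∪ T) + f(S ∩ T) whenever S ⊄ T and T ⊄ S) and strictly increasing (f(S ∪ T) > f(S) for all disjoint S, T with T ≠ ∅). Let v ∈ {−1,0,1}^k with |abs(v)| ≥ 2, and let p be the probability distribution on {−1,1}^k assigning probability 2^{−|abs(v)|} to each y with y_i = v_i for all i ∉ abs(v), and probability 0 otherwise. Then ℓ_abs(v; p) = f(abs(v)), and for every v' ∈ {−1,0,1}^k with v' ≠ v, ℓ_abs(v'; p) > ℓ_abs(v; p); i.e., v is the unique minimizer of ℓ_abs(·; p) over {−1,0,1}^k. -/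

import Mathlib

open Finset
open scoped Classical

noncomputable section

/-- The set `{π_1, …, π_i}` of the first `i` elements under the permutation `π`. -/
def chain (k : ℕ) (π : Equiv.Perm (Fin k)) (i : ℕ) : Finset (Fin k) :=
  (Finset.univ.filter (fun j : Fin k => (j : ℕ) < i)).image π

/-- The Lovász extension of the set function `f`. -/
def lovaszExt (k : ℕ) (f : Finset (Fin k) → ℝ) (x : Fin k → ℝ) : ℝ :=
  Finset.univ.sup' ⟨1, Finset.mem_univ 1⟩
    (fun π : Equiv.Perm (Fin k) =>
      ∑ i : Fin k, x (π i) * (f (chain k π ((i : ℕ) + 1)) - f (chain k π (i : ℕ))))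

/-- A polymatroid: normalized, increasing, submodular. -/
def IsPolymatroid (k : ℕ) (f : Finset (Fin k) → ℝ) : Prop :=
  f ∅ = 0 ∧
  (∀ S T : Finset (Fin k), Disjoint S T → f S ≤ f (S ∪ T)) ∧
  (∀ S T : Finset (Fin k), f (S ∪ T) + f (S ∩ T) ≤ f S + f T)

def IsSign (k : ℕ) (y : Fin k → ℝ) : Prop := ∀ i, y i = 1 ∨ y i = -1

def IsV (k : ℕ) (v : Fin k → ℝ) : Prop := ∀ i, v i = -1 ∨ v i = 0 ∨ v i = 1

/-- The finite set of sign vectors `{-1,1}^k`. -/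
def signVecs (k : ℕ) : Finset (Fin k → ℝ) :=
  Finset.image (fun s : Fin k → Bool => fun i => if s i then (1 : ℝ) else -1) Finset.univ

def misSet (k : ℕ) (v y : Fin k → ℝ) : Finset (Fin k) :=
  Finset.univ.filter (fun i => v i ≠ y i)

def absSet (k : ℕ) (v : Fin k → ℝ) : Finset (Fin k) :=
  Finset.univ.filter (fun i => v i = 0)

/-- The Lovász hinge for a label-indexed collection of set functions. -/
def hinge (k : ℕ) (f : (Fin k → ℝ) → Finset (Fin k) → ℝ) (u y : Fin k → ℝ) : ℝ :=
  lovaszExt k (f y) (fun i => max (1 - u i * y i) 0)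

def clip (k : ℕ) (u : Fin k → ℝ) : Fin k → ℝ := fun i => Real.sign (u i) * min |u i| 1

def indVec (k : ℕ) (π : Equiv.Perm (Fin k)) (i : ℕ) : Fin k → ℝ :=
  fun j => if j ∈ chain k π i then 1 else 0

def Vpy (k : ℕ) (π : Equiv.Perm (Fin k)) (y : Fin k → ℝ) : Set (Fin k → ℝ) :=
  { x | ∃ i ≤ k, x = fun j => indVec k π i j * y j }

def Ppy (k : ℕ) (π : Equiv.Perm (Fin k)) (y : Fin k → ℝ) : Set (Fin k → ℝ) :=
  convexHull ℝ (Vpy k π y)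

def psiHat (k : ℕ) (ε : ℝ) (u : Fin k → ℝ) : Set (Fin k → ℝ) :=
  ⋂₀ { V : Set (Fin k → ℝ) |
      (∃ (π : Equiv.Perm (Fin k)) (y : Fin k → ℝ), IsSign k y ∧ V ⊆ Vpy k π y) ∧
      EMetric.infEdist (clip k u) (convexHull ℝ V) < ENNReal.ofReal ε }

def mval (k : ℕ) (ε : ℝ) (u : Fin k → ℝ) (π : Equiv.Perm (Fin k)) : ℕ → ℝ :=
  fun i => if i = 0 then 1 + ε
    else if h : i ≤ k ∧ 1 ≤ k then |u (π ⟨i - 1, by omega⟩)| else -ε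


/-- Expected structured abstain loss (single polymatroid `f`) under a distribution `p`. -/
def labsE (k : ℕ) (f : Finset (Fin k) → ℝ) (p : (Fin k → ℝ) → ℝ) (v : Fin k → ℝ) : ℝ :=
  ∑ y ∈ signVecs k, p y * (f (misSet k v y \ absSet k v) + f (misSet k v y))

theorem mem_misSet {k : ℕ} {v y : Fin k → ℝ} {i : Fin k} : i ∈ misSet k v y ↔ v i ≠ y i := by
  simp [misSet]

theorem mem_absSet {k : ℕ} {v : Fin k → ℝ} {i : Fin k} : i ∈ absSet k v ↔ v i = 0 := by
  simp [absSet]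

theorem mem_signVecs {k : ℕ} {y : Fin k → ℝ} : y ∈ signVecs k ↔ IsSign k y := by
  simp only [signVecs, mem_image, mem_univ, true_and, IsSign]
  constructor
  · rintro ⟨s, rfl⟩ i
    by_cases h : s i <;> simp [h]
  · intro h
    refine ⟨fun i => decide (y i = 1), funext fun i => ?_⟩
    rcases h i with h | h <;> norm_num [h]

/-- The sign vectors which agree with `v` outside `absSet k v`. -/
def completions (k : ℕ) (v : Fin k → ℝ) : Finset (Fin k → ℝ) :=
  (signVecs k).filter (fun y => ∀ i ∉ absSet k v, y i = v i)

theorem mem_completions {k : ℕ} {v y : Fin k → ℝ} :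
    y ∈ completions k v ↔ IsSign k y ∧ ∀ i, v i ≠ 0 → y i = v i := by
  simp [completions, mem_signVecs, absSet]

theorem card_completions {k : ℕ} {v : Fin k → ℝ} (hv : IsV k v) :
    (completions k v).card = 2 ^ (absSet k v).card := by
  rw [← card_powerset]
  refine card_nbij' (fun y => (absSet k v).filter (fun i => y i = 1))
    (fun S i => if v i = 0 then (if i ∈ S then 1 else -1) else v i) ?_ ?_ ?_ ?_
  · intro y _
    exact mem_coe.2 (mem_powerset.2 (filter_subset _ _))
  · intro S _
    simp only [mem_coe, mem_completions]
    refine ⟨fun i => ?_, fun i hi => by simp [hi]⟩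
    rcases hv i with h | h | h
    · simp [h]
    · by_cases hS : i ∈ S <;> simp [h, hS]
    · simp [h]
  · intro y hy
    obtain ⟨hs, hy⟩ := mem_completions.1 hy
    funext i
    by_cases h : v i = 0
    · rcases hs i with h' | h' <;> norm_num [h, h', mem_absSet]
    · simp [h, hy i h]
  · intro S hS
    have hS : S ⊆ absSet k v := by simpa using hS
    ext i
    by_cases h : i ∈ S
    · have := hS h
      simp_all [mem_absSet]
    · by_cases h' : v i = 0 <;> norm_num [h, h', mem_absSet]

/-- Negation of a vector on the coordinates where `v` vanishes. -/
def flipAbs (k : ℕ) (v y : Fin k → ℝ) : Fin k → ℝ := fun i => if v i = 0 then -y i else y i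

theorem flipAbs_flipAbs {k : ℕ} (v y : Fin k → ℝ) : flipAbs k v (flipAbs k v y) = y := by
  funext i
  by_cases h : v i = 0 <;> simp [flipAbs, h]

theorem flipAbs_mem_completions {k : ℕ} {v y : Fin k → ℝ} (hy : y ∈ completions k v) :
    flipAbs k v y ∈ completions k v := by
  obtain ⟨hs, hy⟩ := mem_completions.1 hy
  refine mem_completions.2 ⟨fun i => ?_, fun i hi => by simp [flipAbs, hi, hy i hi]⟩
  by_cases h : v i = 0 <;> rcases hs i with h' | h' <;> simp [flipAbs, h, h']

theorem sum_flipAbs {k : ℕ} (v : Fin k → ℝ) (g : (Fin k → ℝ) → ℝ) :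
    ∑ y ∈ completions k v, g (flipAbs k v y) = ∑ y ∈ completions k v, g y :=
  sum_nbij' (flipAbs k v) (flipAbs k v) (fun _ => flipAbs_mem_completions)
    (fun _ => flipAbs_mem_completions) (fun _ _ => flipAbs_flipAbs _ _)
    (fun _ _ => flipAbs_flipAbs _ _) (fun _ _ => rfl)

theorem misSet_eq_absSet {k : ℕ} {v y : Fin k → ℝ} (hy : y ∈ completions k v) :
    misSet k v y = absSet k v := by
  obtain ⟨hs, hy⟩ := mem_completions.1 hy
  ext i
  simp only [mem_misSet, mem_absSet]
  refine ⟨fun h => by_contra fun h' => h (hy i h').symm, fun h => ?_⟩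
  rcases hs i with h' | h' <;> norm_num [h, h']

theorem absSet_subset_misSet_union {k : ℕ} (v w : Fin k → ℝ) {y : Fin k → ℝ}
    (hy : y ∈ completions k v) :
    absSet k v ⊆ (misSet k w y \ absSet k w) ∪ misSet k w (flipAbs k v y) := by
  have hs := (mem_completions.1 hy).1
  intro i hi
  have hi : v i = 0 := by simpa [mem_absSet] using hi
  simp only [mem_misSet, mem_absSet, mem_union, mem_sdiff, flipAbs, hi, if_true]
  rcases hs i with h | h
  · by_cases h' : w i = -1 <;> norm_num [h, h']
  · by_cases h' : w i = 1 <;> norm_num [h, h']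

theorem IsPolymatroid.mono {k : ℕ} {f : Finset (Fin k) → ℝ} (hf : IsPolymatroid k f)
    {S T : Finset (Fin k)} (h : S ⊆ T) : f S ≤ f T := by
  simpa [union_sdiff_of_subset h] using hf.2.1 S (T \ S) disjoint_sdiff

theorem IsPolymatroid.nonneg {k : ℕ} {f : Finset (Fin k) → ℝ} (hf : IsPolymatroid k f)
    (S : Finset (Fin k)) : 0 ≤ f S := hf.1 ▸ hf.mono (empty_subset S)

theorem exists_lt_misSet {k : ℕ} {f : Finset (Fin k) → ℝ} (hf : IsPolymatroid k f)
    (hssub : ∀ S T : Finset (Fin k), ¬ S ⊆ T → ¬ T ⊆ S →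
      f (S ∪ T) + f (S ∩ T) < f S + f T)
    (hsinc : ∀ S T : Finset (Fin k), Disjoint S T → T ≠ ∅ → f S < f (S ∪ T))
    {v w : Fin k → ℝ} (hv : IsV k v) (hw : IsV k w) (hA : 2 ≤ (absSet k v).card) (hwv : w ≠ v) :
    ∃ y ∈ completions k v,
      f (absSet k v) < f (misSet k w y \ absSet k w) + f (misSet k w (flipAbs k v y)) := by
  by_cases h : ∃ i, v i ≠ 0 ∧ w i ≠ v i
  · obtain ⟨i, hi, hwi⟩ := h
    obtain ⟨y, hy⟩ : (completions k v).Nonempty := by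
      rw [← card_pos, card_completions hv]
      positivity
    refine ⟨y, hy, ?_⟩
    have hsub := absSet_subset_misSet_union v w hy
    have hyi := (mem_completions.1 hy).2 i hi
    have hmem : i ∈ misSet k w (flipAbs k v y) := by simp [mem_misSet, flipAbs, hi, hyi, hwi]
    have hlt := hsinc (absSet k v) {i} (by simp [mem_absSet, hi]) (by simp)
    have hle := hf.mono (union_subset hsub
      (singleton_subset_iff.2 (mem_union_right (misSet k w y \ absSet k w) hmem)))
    have := hf.2.2 (misSet k w y \ absSet k w) (misSet k w (flipAbs k v y))
    have := hf.nonneg ((misSet k w y \ absSet k w) ∩ misSet k w (flipAbs k v y))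
    linarith
  · push Not at h
    obtain ⟨b, hb⟩ := Function.ne_iff.1 hwv
    have hvb : v b = 0 := by_contra fun h' => hb (h b h')
    have hwb : w b ≠ 0 := hvb ▸ hb
    obtain ⟨c, hc, hcb⟩ := exists_mem_ne (by omega : 1 < (absSet k v).card) b
    have hvc : v c = 0 := by simpa [mem_absSet] using hc
    let y : Fin k → ℝ := fun i => if i = b then -w b else if w i = 0 then 1 else w i
    have hy : y ∈ completions k v := by
      refine mem_completions.2 ⟨fun i => ?_, fun i hi => ?_⟩
      · by_cases hib : i = b
        · rcases hw b with h' | h' | h'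
          · simp [y, hib, h']
          · exact absurd h' hwb
          · simp [y, hib, h']
        · rcases hw i with h' | h' | h' <;> simp [y, hib, h']
      · have hib : i ≠ b := fun e => hi (e ▸ hvb)
        simp [y, hib, h i hi, hi]
    refine ⟨y, hy, ?_⟩
    have hbX : b ∈ misSet k w y \ absSet k w := by
      simp [mem_misSet, mem_absSet, y, hwb, self_eq_neg]
    have hbZ : b ∉ misSet k w (flipAbs k v y) := by simp [mem_misSet, flipAbs, y, hvb]
    have hcX : c ∉ misSet k w y \ absSet k w := by
      by_cases h' : w c = 0 <;> simp [mem_misSet, mem_absSet, y, hcb, h']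
    have hcZ : c ∈ misSet k w (flipAbs k v y) := by
      rcases hw c with h' | h' | h' <;> norm_num [mem_misSet, flipAbs, y, hvc, hcb, h']
    have := hssub _ _ (fun hs => hbZ (hs hbX)) (fun hs => hcX (hs hcZ))
    have := hf.mono (absSet_subset_misSet_union v w hy)
    have := hf.nonneg ((misSet k w y \ absSet k w) ∩ misSet k w (flipAbs k v y))
    linarith

theorem labsE_eq {k : ℕ} (f : Finset (Fin k) → ℝ) {v : Fin k → ℝ} {p : (Fin k → ℝ) → ℝ}
    (hp : ∀ y ∈ signVecs k,
      p y = if ∀ i ∉ absSet k v, y i = v i then ((2:ℝ)^((absSet k v).card))⁻¹ else 0)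
    (w : Fin k → ℝ) :
    labsE k f p w = ((2:ℝ)^((absSet k v).card))⁻¹ *
      ∑ y ∈ completions k v, (f (misSet k w y \ absSet k w) + f (misSet k w y)) := by
  rw [labsE, completions, mul_sum, sum_filter]
  refine sum_congr rfl fun y hy => ?_
  rw [hp y hy, ite_mul, zero_mul]

/-- If `f` is strictly submodular and strictly increasing, `v ∈ {-1,0,1}^k`
abstains on at least two coordinates, and `p` is uniform over the labels agreeing with `v`
off `abs(v)`, then `ℓ_abs(v; p) = f(abs(v))` and `v` is the unique minimizer of
`ℓ_abs(·; p)` over `{-1,0,1}^k`. -/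
theorem tightness_unique_minimizer (k : ℕ) (hk : 2 ≤ k)
    (f : Finset (Fin k) → ℝ) (hf : IsPolymatroid k f)
    (hssub : ∀ S T : Finset (Fin k), ¬ S ⊆ T → ¬ T ⊆ S →
      f (S ∪ T) + f (S ∩ T) < f S + f T)
    (hsinc : ∀ S T : Finset (Fin k), Disjoint S T → T ≠ ∅ → f S < f (S ∪ T))
    (v : Fin k → ℝ) (hv : IsV k v) (hA : 2 ≤ (absSet k v).card)
    (p : (Fin k → ℝ) → ℝ)
    (hp : ∀ y ∈ signVecs k,
      p y = if ∀ i ∉ absSet k v, y i = v i then ((2:ℝ)^((absSet k v).card))⁻¹ else 0) :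
    labsE k f p v = f (absSet k v) ∧
    ∀ v' : Fin k → ℝ, IsV k v' → v' ≠ v → labsE k f p v < labsE k f p v' := by
  have hL : labsE k f p v = f (absSet k v) := by
    rw [labsE_eq f hp, sum_congr rfl fun y hy => by rw [misSet_eq_absSet hy, Finset.sdiff_self, hf.1,
      zero_add], sum_const, card_completions hv, nsmul_eq_mul]
    push_cast
    field_simp
  refine ⟨hL, fun w hw hwv => ?_⟩
  have hlt : ∑ _y ∈ completions k v, f (absSet k v) <
      ∑ y ∈ completions k v,
        (f (misSet k w y \ absSet k w) + f (misSet k w (flipAbs k v y))) := by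
    refine sum_lt_sum (fun y hy => ?_) (exists_lt_misSet hf hssub hsinc hv hw hA hwv)
    have := hf.2.2 (misSet k w y \ absSet k w) (misSet k w (flipAbs k v y))
    have := hf.mono (absSet_subset_misSet_union v w hy)
    have := hf.nonneg ((misSet k w y \ absSet k w) ∩ misSet k w (flipAbs k v y))
    linarith
  rw [sum_add_distrib, sum_flipAbs v (fun y => f (misSet k w y)), ← sum_add_distrib, sum_const,
    card_completions hv, nsmul_eq_mul] at hlt
  push_cast at hlt
  rw [hL, labsE_eq f hp, inv_mul_eq_div, lt_div_iff₀ (by positivity), mul_comm]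
  exact hlt

end
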